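/- Let K be a finitely generated field, let F be an infinite subfield of K, and let R ⊆ K be a finitely generated subring. Then there exists a subfield K' ⊆ K containing F such that the extension K/K' is purely inseparable, and for every integer r ≥ 1 one can find r discrete valuations v_1, …, v_r of K such that: (1) for each i = 1, …, r, the completion K_{v_i} is locally compact, the ring R is contained in the valuation ring 𝒪(K_{v_i}), and the closures of F and of K' in K_{v_i} coincide; and (2) for i ≠ j, the residue fields of K_{v_i} and K_{v_j} are finite of different cardinalities. -/

import Mathlib

open IsLocalRing Polynomial

/-- A local model of `A` at `π`: a Henselian discrete valuation ring `O` over `A` with uniformizer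
`π`, finite residue field and dense image of `A`, that is too large to be algebraic over a
countable ring. -/
structure IsLocalModel {A : Type} [CommRing A] (π : A) (O : Type) [CommRing O] [IsDomain O]
    [IsDiscreteValuationRing O] [Algebra A O] : Prop where
  henselian : HenselianLocalRing O
  injective : Function.Injective (algebraMap A O)
  irreducible : Irreducible (algebraMap A O π)
  exists_sub_mem : ∀ x : O, ∃ a : A, x - algebraMap A O a ∈ maximalIdeal O
  finite : Finite (ResidueField O)
  uncountable : Uncountable O

/-- Every prime of `A` admits a local model. -/
def HasLocalModels (A : Type) [CommRing A] : Prop :=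
  ∀ π : A, Prime π → ∃ (O : Type) (_ : CommRing O) (_ : IsDomain O)
    (_ : IsDiscreteValuationRing O) (_ : Algebra A O), IsLocalModel π O

theorem henselianLocalRing_of_isAdicComplete (R : Type*) [CommRing R] [IsLocalRing R]
    [IsAdicComplete (maximalIdeal R) R] : HenselianLocalRing R where
  is_henselian f hf a h1 h2 :=
    HenselianRing.is_henselian (I := maximalIdeal R) f hf a h1 (h2.map (Ideal.Quotient.mk _))

theorem PadicInt.uncountable (p : ℕ) [Fact p.Prime] : Uncountable ℤ_[p] := by
  rw [← not_countable_iff]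
  intro h
  have : Countable ℚ_[p] :=
    (IsLocalization.mk'_surjective (nonZeroDivisors ℤ_[p]) (S := ℚ_[p])).countable
  have h1 := continuum_le_cardinal_of_nontriviallyNormedField ℚ_[p]
  exact absurd (h1.trans (Cardinal.mk_le_aleph0 (α := ℚ_[p])))
    (not_le.2 Cardinal.aleph0_lt_continuum)

theorem hasLocalModels_int : HasLocalModels ℤ := by
  intro π hπ
  have hp : Fact (π.natAbs).Prime := ⟨Int.prime_iff_natAbs_prime.1 hπ⟩
  refine ⟨ℤ_[π.natAbs], inferInstance, inferInstance, inferInstance, inferInstance, ?_⟩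
  have h : Associated ((π.natAbs : ℤ) : ℤ_[π.natAbs]) (π : ℤ_[π.natAbs]) :=
    (Int.associated_natAbs π).symm.map (Int.castRingHom ℤ_[π.natAbs])
  refine ⟨henselianLocalRing_of_isAdicComplete _, by simpa using Int.cast_injective, ?_,
    fun x ↦ ?_, ?_, PadicInt.uncountable _⟩
  · exact h.irreducible (by rw [Int.cast_natCast]; exact PadicInt.irreducible_p)
  · exact ⟨x.zmodRepr, by simpa using PadicInt.sub_zmodRepr_mem x⟩
  · exact .of_equiv _ (PadicInt.residueField (p := π.natAbs)).symm.toEquiv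

instance PowerSeries.isAdicComplete (k : Type*) [Field k] :
    IsAdicComplete (maximalIdeal (PowerSeries k)) (PowerSeries k) where
  haus' f hf := by
    ext n
    have := hf (n + 1)
    rw [SModEq.zero, smul_eq_mul, Ideal.mul_top, PowerSeries.maximalIdeal_eq_span_X,
      Ideal.span_singleton_pow, Ideal.mem_span_singleton, PowerSeries.X_pow_dvd_iff] at this
    simpa using this n (by simp)
  prec' f hf := by
    refine ⟨PowerSeries.mk fun n ↦ PowerSeries.coeff n (f (n + 1)), fun n ↦ ?_⟩
    rw [SModEq.sub_mem, smul_eq_mul, Ideal.mul_top, PowerSeries.maximalIdeal_eq_span_X,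
      Ideal.span_singleton_pow, Ideal.mem_span_singleton, PowerSeries.X_pow_dvd_iff]
    intro m hm
    have := hf (Nat.succ_le_of_lt hm)
    rw [SModEq.sub_mem, smul_eq_mul, Ideal.mul_top, PowerSeries.maximalIdeal_eq_span_X,
      Ideal.span_singleton_pow, Ideal.mem_span_singleton, PowerSeries.X_pow_dvd_iff] at this
    have := this m (by simp)
    rw [map_sub, sub_eq_zero] at this ⊢
    rw [PowerSeries.coeff_mk, ← this]

theorem PowerSeries.uncountable (k : Type*) [Field k] : Uncountable (PowerSeries k) := by
  rw [← not_countable_iff]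
  intro h
  obtain ⟨g, hg⟩ := exists_injective_nat (PowerSeries k)
  refine Function.cantor_injective
    (fun s : Set ℕ ↦ g (PowerSeries.mk (s.indicator (1 : ℕ → k)))) fun s t hst ↦ ?_
  refine Set.indicator_one_inj k (funext fun n ↦ ?_)
  simpa using congrArg (PowerSeries.coeff n) (hg hst)

theorem hasLocalModels_polynomial (p : ℕ) [Fact p.Prime] : HasLocalModels (ZMod p)[X] := by
  intro π hπ
  have : Fact (Irreducible π) := ⟨hπ.irreducible⟩
  let k := AdjoinRoot π
  have hfin : Module.Finite (ZMod p) k := (AdjoinRoot.powerBasis hπ.ne_zero).finite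
  have : Finite k := Module.finite_of_finite (ZMod p)
  let θ : k := AdjoinRoot.root π
  let φ : (ZMod p)[X] →+* PowerSeries k := Polynomial.coeToPowerSeries.ringHom.comp
    ((Polynomial.taylorAlgHom θ).toRingHom.comp (Polynomial.mapRingHom (algebraMap (ZMod p) k)))
  have hφ (f : (ZMod p)[X]) (n : ℕ) : PowerSeries.coeff n (φ f) =
      ((f.map (algebraMap (ZMod p) k)).taylor θ).coeff n := by
    simp [φ]
  let : Algebra (ZMod p)[X] (PowerSeries k) := φ.toAlgebra
  have hmem (x : PowerSeries k) :
      x ∈ maximalIdeal (PowerSeries k) ↔ PowerSeries.coeff 0 x = 0 := by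
    rw [PowerSeries.maximalIdeal_eq_span_X, Ideal.mem_span_singleton, PowerSeries.X_dvd_iff,
      PowerSeries.coeff_zero_eq_constantCoeff_apply]
  refine ⟨PowerSeries k, inferInstance, inferInstance, inferInstance, inferInstance, ?_⟩
  refine ⟨henselianLocalRing_of_isAdicComplete _, ?_, ?_, fun x ↦ ?_, ?_, ?_⟩
  · intro f g hfg
    refine Polynomial.map_injective _ (algebraMap (ZMod p) k).injective
      (Polynomial.taylor_injective θ (Polynomial.ext fun n ↦ ?_))
    rw [← hφ, ← hφ]
    exact congrArg _ hfg
  · have h0 : PowerSeries.constantCoeff (φ π) = 0 := by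
      rw [← PowerSeries.coeff_zero_eq_constantCoeff_apply, hφ, Polynomial.taylor_coeff_zero,
        Polynomial.eval_map_algebraMap]
      exact AdjoinRoot.eval₂_root π
    have h1 : PowerSeries.coeff 1 (φ π) ≠ 0 := by
      rw [hφ, Polynomial.taylor_coeff_one, Polynomial.derivative_map,
        Polynomial.eval_map_algebraMap]
      refine (PerfectField.separable_of_irreducible hπ.irreducible).aeval_derivative_ne_zero ?_
      exact AdjoinRoot.eval₂_root π
    obtain ⟨g, hg⟩ := PowerSeries.X_dvd_iff.2 h0
    have hu : IsUnit g := by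
      rw [PowerSeries.isUnit_iff_constantCoeff, isUnit_iff_ne_zero]
      rwa [hg, ← zero_add 1, PowerSeries.coeff_succ_X_mul,
        PowerSeries.coeff_zero_eq_constantCoeff_apply] at h1
    change Irreducible (φ π)
    rw [hg]
    exact (irreducible_mul_isUnit hu).2 PowerSeries.X_irreducible
  · obtain ⟨f, hf⟩ := AdjoinRoot.mk_surjective (PowerSeries.coeff 0 x)
    refine ⟨f, (hmem _).2 ?_⟩
    rw [map_sub, sub_eq_zero]
    change _ = PowerSeries.coeff 0 (φ f)
    rw [hφ, Polynomial.taylor_coeff_zero, Polynomial.eval_map_algebraMap, ← hf]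
    exact (AdjoinRoot.aeval_eq f).symm
  · exact .of_equiv _ (PowerSeries.residueFieldOfPowerSeries (k := k)).symm.toEquiv
  · exact PowerSeries.uncountable k

theorem exists_algebraicIndependent_of_uncountable (A O ι : Type) [CommRing A] [Countable A]
    [CommRing O] [IsDomain O] [Algebra A O] (hinj : Function.Injective (algebraMap A O))
    [Uncountable O] [Finite ι] : ∃ y : ι → O, AlgebraicIndependent A y := by
  have : FaithfulSMul A O := (faithfulSMul_iff_algebraMap_injective A O).2 hinj
  have : IsDomain A := hinj.isDomain (algebraMap A O)
  obtain ⟨s, hs⟩ := exists_isTranscendenceBasis A O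
  have hinf : Infinite s := by
    by_contra h
    rw [not_infinite_iff_finite] at h
    have hcount : Countable (MvPolynomial s A) := by
      rw [← Cardinal.mk_le_aleph0_iff]
      refine MvPolynomial.cardinalMk_le_max.trans ?_
      simp
    have : Countable (Algebra.adjoin A (Set.range ((↑) : s → O))) :=
      hs.1.aevalEquiv.symm.injective.countable
    have := hs.isAlgebraic
    have h1 := Algebra.IsAlgebraic.cardinalMk_le_max
      (Algebra.adjoin A (Set.range ((↑) : s → O))) O
    rw [max_eq_right (Cardinal.mk_le_aleph0_iff.2 inferInstance)] at h1
    exact not_countable (Cardinal.mk_le_aleph0_iff.1 h1)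
  let e : ι ↪ s := (Finite.equivFin ι).toEmbedding.trans
    (Fin.valEmbedding.trans (Infinite.natEmbedding s))
  exact ⟨_, hs.1.comp e e.injective⟩

theorem AlgebraicIndependent.const_add_mul {A O ι : Type*} [CommRing A] [IsDomain A] [Infinite A]
    [CommRing O] [Algebra A O] [Finite ι] {y : ι → O} (hy : AlgebraicIndependent A y)
    (a : ι → A) {c : A} (hc : c ≠ 0) :
    AlgebraicIndependent A fun i ↦ algebraMap A O (a i) + algebraMap A O c * y i := by
  rw [algebraicIndependent_iff]
  intro f hf
  have h1 : MvPolynomial.aeval y (MvPolynomial.aeval (fun i ↦ (MvPolynomial.C (a i) +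
      MvPolynomial.C c * MvPolynomial.X i : MvPolynomial ι A)) f) = 0 := by
    rw [← hf, MvPolynomial.comp_aeval_apply]
    simp
  have h2 := (algebraicIndependent_iff.1 hy) _ h1
  refine MvPolynomial.funext_set (fun i ↦ Set.range fun x ↦ a i + c * x)
    (fun i ↦ Set.infinite_range_of_injective fun x y h ↦ by simpa [hc] using h) fun x hx ↦ ?_
  choose z hz using fun i ↦ hx i trivial
  have h3 := congrArg (MvPolynomial.eval z) h2
  rw [map_zero] at h3 ⊢
  rw [← h3, ← MvPolynomial.aeval_eq_eval, ← MvPolynomial.aeval_eq_eval,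
    MvPolynomial.comp_aeval_apply]
  simp only [map_add, map_mul, MvPolynomial.aeval_C, MvPolynomial.aeval_X]
  congr 2
  exact funext fun i ↦ (hz i).symm

theorem Polynomial.exists_eval_ne_zero_not_isUnit {A : Type*} [CommRing A] [IsDomain A]
    [Infinite A] [Finite Aˣ] {h : A[X]} (hdeg : 0 < h.natDegree) :
    ∃ x, h.eval x ≠ 0 ∧ ¬ IsUnit (h.eval x) := by
  by_contra! H
  have hS : (insert (0 : A) (Set.range ((↑) : Aˣ → A))).Finite :=
    (Set.finite_range _).insert _
  have hfin : (⋃ s ∈ insert (0 : A) (Set.range ((↑) : Aˣ → A)),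
      {x | (h - C s).IsRoot x}).Finite := by
    refine hS.biUnion fun s _ ↦ Polynomial.finite_setOfPred_isRoot fun h0 ↦ ?_
    rw [sub_eq_zero] at h0
    simp [h0] at hdeg
  refine Set.infinite_univ (hfin.subset fun x _ ↦ ?_)
  simp only [Set.mem_iUnion]
  refine ⟨h.eval x, ?_, by simp⟩
  by_cases h0 : h.eval x = 0
  · exact .inl h0
  · exact .inr (H x h0)

/-- A nonconstant polynomial has roots modulo infinitely many primes. -/
theorem Polynomial.exists_prime_dvd_eval {A : Type*} [CommRing A] [IsDomain A]
    [UniqueFactorizationMonoid A] [Infinite A] [Finite Aˣ] {f : A[X]} (hdeg : 0 < f.natDegree)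
    {q : A} (hq : q ≠ 0) : ∃ π : A, Prime π ∧ ¬ π ∣ q ∧ ∃ b, π ∣ f.eval b := by
  have key (g : A[X]) (hg : 0 < (1 + C q * X * g).natDegree)
      (H : ∀ x, ∃ b, (1 + C q * X * g).eval x ∣ f.eval b) :
      ∃ π : A, Prime π ∧ ¬ π ∣ q ∧ ∃ b, π ∣ f.eval b := by
    obtain ⟨x, h0, hu⟩ := exists_eval_ne_zero_not_isUnit hg
    obtain ⟨π, hπ, hdvd⟩ := WfDvdMonoid.exists_irreducible_factor hu h0
    obtain ⟨b, hb⟩ := H x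
    refine ⟨π, hπ.prime, fun hπq ↦ hπ.not_isUnit ?_, b, hdvd.trans hb⟩
    rw [isUnit_iff_dvd_one]
    have : π ∣ q * (x * g.eval x) := hπq.mul_right _
    simpa [mul_assoc] using (dvd_sub hdvd this)
  have hdeg' (g : A[X]) (hg : g ≠ 0) : 0 < (1 + C q * X * g).natDegree := by
    have h1 : (C q * X * g).natDegree = g.natDegree + 1 := by
      rw [mul_assoc, natDegree_C_mul hq, natDegree_X_mul hg]
    rw [add_comm, ← C_1, natDegree_add_C, h1]
    omega
  by_cases hc : f.eval 0 = 0
  · exact key 1 (hdeg' 1 one_ne_zero) fun x ↦ ⟨0, by simp [hc]⟩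
  · have hX : f.divX ≠ 0 := fun h ↦ by
      rw [divX_eq_zero_iff.1 h, natDegree_C] at hdeg
      exact hdeg.false
    have hne : f.divX.comp (C (f.eval 0 * q) * X) ≠ 0 := by
      rw [Ne, Polynomial.comp_C_mul_X_eq_zero_iff]
      · exact hX
      · exact mem_nonZeroDivisors_of_ne_zero (mul_ne_zero hc hq)
    refine key _ (hdeg' _ hne) fun x ↦ ⟨f.eval 0 * q * x, f.eval 0, ?_⟩
    conv_lhs => rw [← divX_mul_X_add f]
    rw [coeff_zero_eq_eval_zero]
    simp
    ring

section

variable {B E M : Type*} [CommRing B] [IsDomain B] [Field E] [Algebra B E] [IsFractionRing B E]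
  [Field M] [Algebra E M] [Algebra B M] [IsScalarTower B E M]

theorem exists_adjoin_eq_top [FiniteDimensional E M] [Algebra.IsSeparable E M] :
    ∃ α : M, Algebra.adjoin E {α} = ⊤ := by
  obtain ⟨α, hα⟩ := Field.exists_primitive_element E M
  refine ⟨α, ?_⟩
  have h := IntermediateField.adjoin_simple_toSubalgebra_of_isAlgebraic
      (Algebra.IsAlgebraic.isAlgebraic (R := E) α)
  rw [hα] at h
  exact h.symm.trans IntermediateField.top_toSubalgebra

theorem adjoin_singleton_smul_eq_top {m : B} (hm : m ∈ nonZeroDivisors B) {α : M}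
    (hα : Algebra.adjoin E {α} = ⊤) : Algebra.adjoin E {m • α} = ⊤ := by
  have hne : algebraMap B E m ≠ 0 := IsFractionRing.to_map_ne_zero_of_mem_nonZeroDivisors hm
  have h : α = algebraMap E M (algebraMap B E m)⁻¹ * (m • α) := by
    rw [Algebra.smul_def m α, IsScalarTower.algebraMap_apply B E M, ← mul_assoc, ← map_mul,
      inv_mul_cancel₀ hne, map_one, one_mul]
  have h2 : α ∈ Algebra.adjoin E {m • α} := by
    generalize m • α = x at h
    rw [h]
    exact mul_mem (Subalgebra.algebraMap_mem _ _) (Algebra.self_mem_adjoin_singleton E x)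
  rw [eq_top_iff, ← hα, Algebra.adjoin_le_iff, Set.singleton_subset_iff]
  exact h2

variable (B E M) in
theorem exists_isIntegral_adjoin_eq_top [FiniteDimensional E M] [Algebra.IsSeparable E M] :
    ∃ α : M, IsIntegral B α ∧ Algebra.adjoin E {α} = ⊤ := by
  obtain ⟨α, hα⟩ := exists_adjoin_eq_top (E := E) (M := M)
  obtain ⟨⟨m, hm0⟩, hm⟩ := IsIntegral.exists_multiple_integral_of_isLocalization
    (nonZeroDivisors B) (Rₘ := E) α (Algebra.IsIntegral.isIntegral α)
  exact ⟨m • α, hm, adjoin_singleton_smul_eq_top hm0 hα⟩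

theorem exists_aeval_eq_mul {α : M} (hα : Algebra.adjoin E {α} = ⊤) (τ : M) :
    ∃ (g : B[X]) (h : B), h ≠ 0 ∧ aeval α g = algebraMap B M h * τ := by
  have hτ : τ ∈ Algebra.adjoin E {α} := hα ▸ trivial
  rw [Algebra.adjoin_singleton_eq_range_aeval] at hτ
  obtain ⟨G, rfl⟩ := hτ
  obtain ⟨b, hb, hG⟩ := IsLocalization.integerNormalization_spec (nonZeroDivisors B) G
  refine ⟨IsLocalization.integerNormalization (nonZeroDivisors B) G, b,
    nonZeroDivisors.ne_zero hb, ?_⟩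
  rw [← aeval_map_algebraMap E, hG, ← algebraMap_smul E b G, map_smul, algebraMap_smul,
    Algebra.smul_def]
  rfl

theorem exists_ringHom_fractionRing [IsIntegrallyClosed B] {α : M} (hint : IsIntegral B α)
    (hα : Algebra.adjoin E {α} = ⊤) {O : Type*} [CommRing O] [IsDomain O] (ev : B →+* O)
    (hev : Function.Injective ev) {β : O} (hβ : eval₂ ev β (minpoly B α) = 0) :
    ∃ φ : M →+* FractionRing O,
      (∀ b, φ (algebraMap B M b) = algebraMap O (FractionRing O) (ev b)) ∧
        φ α = algebraMap O (FractionRing O) β := by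
  have hinj : Function.Injective ((algebraMap O (FractionRing O)).comp ev) :=
    (IsFractionRing.injective O (FractionRing O)).comp hev
  let : Algebra E (FractionRing O) := (IsFractionRing.lift hinj).toAlgebra
  have hEO (b : B) : algebraMap E (FractionRing O) (algebraMap B E b) =
      algebraMap O (FractionRing O) (ev b) := IsFractionRing.lift_algebraMap hinj b
  have hintE : IsIntegral E α := hint.tower_top
  let pb := PowerBasis.ofAdjoinEqTop hintE hα
  have hroot : aeval (algebraMap O (FractionRing O) β) (minpoly E pb.gen) = 0 := by
    rw [PowerBasis.ofAdjoinEqTop_gen, minpoly.isIntegrallyClosed_eq_field_fractions' E hint,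
      aeval_def, eval₂_map]
    have : (algebraMap E (FractionRing O)).comp (algebraMap B E) =
        (algebraMap O (FractionRing O)).comp ev := RingHom.ext hEO
    rw [this, ← hom_eval₂, hβ, map_zero]
  refine ⟨(pb.lift _ hroot).toRingHom, fun b ↦ ?_, ?_⟩
  · rw [IsScalarTower.algebraMap_apply B E M, ← hEO]
    exact (pb.lift _ hroot).commutes _
  · have := pb.lift_gen _ hroot
    rwa [PowerBasis.ofAdjoinEqTop_gen] at this

end

theorem exists_specialization {A : Type} [CommRing A] [IsDomain A] [IsPrincipalIdealRing A]
    [Infinite A] [Countable A] [Finite Aˣ] (hA : HasLocalModels A) {ι : Type} [Finite ι]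
    {f g u : (MvPolynomial ι A)[X]} (hf : f.Monic) (hdeg : 0 < f.natDegree)
    {Δ h : MvPolynomial ι A} (hΔ : Δ ≠ 0) (hh : h ∣ Δ) (hgf : g * derivative f = C h + f * u) :
    ∃ (π : A) (_ : Prime π) (O : Type) (_ : CommRing O) (_ : IsDomain O)
      (_ : IsDiscreteValuationRing O) (_ : Algebra A O) (_ : IsLocalModel π O)
      (ev : MvPolynomial ι A →ₐ[A] O) (β : O), Function.Injective ev ∧ IsUnit (ev Δ) ∧
        eval₂ (ev : MvPolynomial ι A →+* O) β f = 0 := by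
  obtain ⟨a, ha⟩ : ∃ a : ι → A, MvPolynomial.eval a Δ ≠ 0 := by
    by_contra! H
    exact hΔ (MvPolynomial.funext fun x ↦ by rw [H, map_zero])
  obtain ⟨π, hπ, hπΔ, b, hb⟩ := exists_prime_dvd_eval
    (f := f.map (MvPolynomial.eval a)) (by rwa [hf.natDegree_map]) ha
  obtain ⟨O, _, _, _, _, hO⟩ := hA π hπ
  have := hO.henselian
  have := hO.uncountable
  obtain ⟨y, hy⟩ := exists_algebraicIndependent_of_uncountable A O ι hO.injective
  have hy' := hy.const_add_mul a hπ.ne_zero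
  let ev : MvPolynomial ι A →ₐ[A] O := MvPolynomial.aeval fun i ↦
    algebraMap A O (a i) + algebraMap A O π * y i
  let I := maximalIdeal O
  have hπI : algebraMap A O π ∈ I := (mem_maximalIdeal _).2 hO.irreducible.not_isUnit
  have hred (x : MvPolynomial ι A) : residue O (ev x) =
      residue O (algebraMap A O (MvPolynomial.eval a x)) := by
    have : ((residue O).comp (ev : MvPolynomial ι A →+* O)) =
        (residue O).comp ((algebraMap A O).comp (MvPolynomial.eval a)) := by
      refine MvPolynomial.ringHom_ext (fun r ↦ by simp [ev]) fun i ↦ ?_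
      have h0 : residue O (algebraMap A O π) = 0 := (residue_eq_zero_iff _).2 hπI
      simp [ev, h0]
    exact DFunLike.congr_fun this x
  have hunit : IsUnit (ev Δ) := by
    rw [← residue_ne_zero_iff_isUnit, hred, residue_ne_zero_iff_isUnit]
    obtain ⟨r, s, hrs⟩ := (hπ.irreducible.coprime_iff_not_dvd).2 hπΔ
    by_contra hu
    have h1 : algebraMap A O (r * π + s * MvPolynomial.eval a Δ) ∈ I := by
      rw [map_add, map_mul, map_mul]
      exact I.add_mem (I.mul_mem_left _ hπI) (I.mul_mem_left _ ((mem_maximalIdeal _).2 hu))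
    rw [hrs, map_one] at h1
    exact (Ideal.ne_top_iff_one _).1 (maximalIdeal.isMaximal O).ne_top h1
  let b' := algebraMap A O b
  have hevb (p : (MvPolynomial ι A)[X]) :
      residue O ((p.map (ev : MvPolynomial ι A →+* O)).eval b') =
        residue O (algebraMap A O ((p.map (MvPolynomial.eval a)).eval b)) := by
    rw [eval_map, hom_eval₂, eval_map, hom_eval₂, hom_eval₂]
    congr 1
    exact RingHom.ext hred
  have hfb : (f.map (ev : MvPolynomial ι A →+* O)).eval b' ∈ I := by
    rw [← residue_eq_zero_iff, hevb, residue_eq_zero_iff]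
    obtain ⟨c, hc⟩ := hb
    rw [hc, map_mul]
    exact I.mul_mem_right _ hπI
  have hder : IsUnit ((f.map (ev : MvPolynomial ι A →+* O)).derivative.eval b') := by
    have h1 := congrArg (fun p ↦ (p.map (ev : MvPolynomial ι A →+* O)).eval b') hgf
    simp only [Polynomial.map_mul, Polynomial.map_add, eval_mul, eval_add, map_C, eval_C] at h1
    have h2 : IsUnit (ev h) := isUnit_of_dvd_unit (map_dvd ev hh) hunit
    rw [derivative_map]
    refine isUnit_of_mul_isUnit_right (x := eval b' (g.map (ev : MvPolynomial ι A →+* O))) ?_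
    rw [h1, ← residue_ne_zero_iff_isUnit, map_add, map_mul, (residue_eq_zero_iff _).2 hfb, zero_mul,
      add_zero, residue_ne_zero_iff_isUnit]
    exact h2
  obtain ⟨β, hβ, -⟩ := HenselianLocalRing.is_henselian _ (hf.map _) b' hfb hder
  exact ⟨π, hπ, O, _, _, _, _, hO, ev, β, hy', hunit, by rwa [IsRoot, eval_map] at hβ⟩

/-- A finite separable extension of a rational function field over `A` embeds into the fraction
field of a local model of `A`, with prescribed elements mapped to integers. -/
theorem exists_embedding_of_isSeparable {A : Type} [CommRing A] [IsDomain A]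
    [IsPrincipalIdealRing A] [Infinite A] [Countable A] [Finite Aˣ] (hA : HasLocalModels A)
    {ι : Type} [Finite ι] (E : Type) {M : Type} [Field E] [Algebra (MvPolynomial ι A) E]
    [IsFractionRing (MvPolynomial ι A) E] [Field M] [Algebra E M] [Algebra (MvPolynomial ι A) M]
    [IsScalarTower (MvPolynomial ι A) E M] [FiniteDimensional E M] [Algebra.IsSeparable E M]
    (T : Finset M) :
    ∃ (π : A) (O : Type) (_ : CommRing O) (_ : IsDomain O)
      (_ : IsDiscreteValuationRing O) (_ : Algebra A O) (_ : IsLocalModel π O)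
      (φ : M →+* FractionRing O),
      (∀ a, φ (algebraMap (MvPolynomial ι A) M (MvPolynomial.C a)) =
        algebraMap O (FractionRing O) (algebraMap A O a)) ∧
      ∀ τ ∈ T, φ τ ∈ (algebraMap O (FractionRing O)).range := by
  classical
  obtain ⟨α, hint, hα⟩ := exists_isIntegral_adjoin_eq_top (MvPolynomial ι A) E M
  have : FaithfulSMul (MvPolynomial ι A) M := FaithfulSMul.trans (MvPolynomial ι A) E M
  have hmin : minpoly E α = (minpoly (MvPolynomial ι A) α).map (algebraMap _ E) :=
    minpoly.isIntegrallyClosed_eq_field_fractions' E hint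
  set f := minpoly (MvPolynomial ι A) α with hf
  have hder : aeval α (derivative f) ≠ 0 := by
    have := (Algebra.IsSeparable.isSeparable E α).aeval_derivative_ne_zero (minpoly.aeval E α)
    rwa [hmin, derivative_map, aeval_map_algebraMap] at this
  choose g h hh hgh using exists_aeval_eq_mul (B := MvPolynomial ι A) hα
  let τ₀ := (aeval α (derivative f))⁻¹
  obtain ⟨u, hu⟩ : f ∣ g τ₀ * derivative f - C (h τ₀) := by
    refine minpoly.isIntegrallyClosed_dvd hint ?_
    rw [map_sub, map_mul, hgh, mul_assoc, inv_mul_cancel₀ hder, aeval_C, mul_one, sub_self]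
  obtain ⟨π, hπ, O, _, _, _, _, hO, ev, β, hev, hunit, hβ⟩ := exists_specialization hA
    (Δ := ∏ τ ∈ insert τ₀ T, h τ) (minpoly.monic hint) (minpoly.natDegree_pos hint)
    (Finset.prod_ne_zero_iff.2 fun τ _ ↦ hh τ)
    (Finset.dvd_prod_of_mem h (Finset.mem_insert_self _ _)) (sub_eq_iff_eq_add'.1 hu)
  obtain ⟨φ, hφ, hφα⟩ := exists_ringHom_fractionRing hint hα (ev : MvPolynomial ι A →+* O) hev hβ
  refine ⟨π, O, _, _, _, _, hO, φ, fun a ↦ ?_, fun τ hτ ↦ ?_⟩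
  · rw [hφ]
    exact congrArg _ (ev.commutes a)
  · have hu : IsUnit (ev (h τ)) := isUnit_of_dvd_unit
      (map_dvd ev (Finset.dvd_prod_of_mem h (Finset.mem_insert_of_mem hτ))) hunit
    obtain ⟨c, hc⟩ := hu.exists_left_inv
    refine ⟨c * eval₂ (ev : MvPolynomial ι A →+* O) β (g τ), ?_⟩
    have h1 := congrArg φ (hgh τ)
    rw [map_mul, hφ, aeval_def, hom_eval₂, hφα] at h1
    have h2 : φ.comp (algebraMap (MvPolynomial ι A) M) =
        (algebraMap O (FractionRing O)).comp (ev : MvPolynomial ι A →+* O) := RingHom.ext hφ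
    rw [map_mul, hom_eval₂, ← h2, h1, ← mul_assoc, ← map_mul]
    change algebraMap O _ (c * ev (h τ)) * _ = _
    rw [hc, map_one, one_mul]

/-- Any finite subset of the `A`-field `M` can be mapped to integers by an `A`-embedding of `M`
into the fraction field of a local model of `A`. -/
def HasLocalEmbeddings (A M : Type) [CommRing A] [Field M] [Algebra A M] : Prop :=
  ∀ T : Finset M, ∃ (π : A) (O : Type) (_ : CommRing O) (_ : IsDomain O)
    (_ : IsDiscreteValuationRing O) (_ : Algebra A O) (_ : IsLocalModel π O)
    (φ : M →+* FractionRing O),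
    (∀ a, φ (algebraMap A M a) = algebraMap O (FractionRing O) (algebraMap A O a)) ∧
    ∀ τ ∈ T, φ τ ∈ (algebraMap O (FractionRing O)).range

theorem exists_isFractionRing_adjoin {A k M : Type*} [CommRing A] [IsDomain A] [Field k]
    [Algebra A k] [IsFractionRing A k] [Field M] [Algebra k M] [Algebra A M] [IsScalarTower A k M]
    {s : Set M} (hs : AlgebraicIndependent k ((↑) : s → M)) :
    ∃ f : MvPolynomial s A →ₐ[A] IntermediateField.adjoin k s,
      @IsFractionRing _ _ (IntermediateField.adjoin k s) _ f.toRingHom.toAlgebra := by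
  let E := IntermediateField.adjoin k s
  let f : MvPolynomial s A →ₐ[A] E :=
    MvPolynomial.aeval fun i : s ↦ ⟨i, IntermediateField.subset_adjoin k s i.2⟩
  have hAk : Function.Injective (algebraMap A k) := IsFractionRing.injective A k
  have hs' : AlgebraicIndependent A ((↑) : s → M) := hs.restrictScalars hAk
  have : IsScalarTower A E M := .of_algebraMap_eq fun _ ↦ rfl
  have hf (p : MvPolynomial s A) : (f p : M) = MvPolynomial.aeval ((↑) : s → M) p := by
    have : ((IsScalarTower.toAlgHom A E M).comp f) = MvPolynomial.aeval ((↑) : s → M) := by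
      ext i
      simp [f]
    exact DFunLike.congr_fun this p
  have hinj : Function.Injective f := fun x y hxy ↦ hs' (by rw [← hf, ← hf, hxy])
  refine ⟨f, ?_⟩
  let : Algebra (MvPolynomial s A) E := f.toRingHom.toAlgebra
  have : FaithfulSMul (MvPolynomial s A) E := (faithfulSMul_iff_algebraMap_injective _ _).2 hinj
  refine IsFractionRing.of_field _ _ fun z ↦ ?_
  suffices ∀ x ∈ IntermediateField.adjoin k s, ∃ a b, x = (f a : M) / (f b : M) by
    obtain ⟨a, b, h⟩ := this z z.2
    exact ⟨a, b, Subtype.ext h⟩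
  intro x hx
  induction hx using IntermediateField.adjoin_induction with
  | mem x hx => exact ⟨MvPolynomial.X ⟨x, hx⟩, 1, by simp [f]⟩
  | algebraMap x =>
    obtain ⟨a, b, -, rfl⟩ := IsFractionRing.div_surjective A x
    refine ⟨MvPolynomial.C a, MvPolynomial.C b, ?_⟩
    rw [hf, hf, MvPolynomial.aeval_C, MvPolynomial.aeval_C, map_div₀,
      ← IsScalarTower.algebraMap_apply, ← IsScalarTower.algebraMap_apply]
  | inv x _ h =>
    obtain ⟨a, b, rfl⟩ := h
    exact ⟨b, a, inv_div _ _⟩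
  | mul x y _ _ hx hy =>
    obtain ⟨a, b, rfl⟩ := hx
    obtain ⟨c, d, rfl⟩ := hy
    refine ⟨a * c, b * d, ?_⟩
    rw [map_mul, map_mul, MulMemClass.coe_mul, MulMemClass.coe_mul, div_mul_div_comm]
  | add x y _ _ hx hy =>
    obtain ⟨a, b, rfl⟩ := hx
    obtain ⟨c, d, rfl⟩ := hy
    by_cases hb : (f b : M) = 0
    · exact ⟨c, d, by rw [hb, div_zero, zero_add]⟩
    by_cases hd : (f d : M) = 0
    · exact ⟨a, b, by rw [hd, div_zero, add_zero]⟩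
    refine ⟨a * d + b * c, b * d, ?_⟩
    rw [map_mul, map_add, map_mul, map_mul, MulMemClass.coe_mul, AddMemClass.coe_add,
      MulMemClass.coe_mul, MulMemClass.coe_mul, div_add_div _ _ hb hd]

theorem hasLocalEmbeddings_of_isTranscendenceBasis {A k M : Type} [CommRing A] [IsDomain A]
    [IsPrincipalIdealRing A] [Infinite A] [Countable A] [Finite Aˣ] (hA : HasLocalModels A)
    [Field k] [Algebra A k] [IsFractionRing A k] [Field M] [Algebra k M] [Algebra A M]
    [IsScalarTower A k M] [Algebra.EssFiniteType k M] {s : Finset M}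
    (hs : IsTranscendenceBasis k ((↑) : s → M))
    (hsep : Algebra.IsSeparable (IntermediateField.adjoin k (s : Set M)) M) :
    HasLocalEmbeddings A M := by
  intro T
  obtain ⟨f, hf⟩ := exists_isFractionRing_adjoin (A := A) (s := (s : Set M)) hs.1
  let E := IntermediateField.adjoin k (s : Set M)
  let : Algebra (MvPolynomial s A) E := f.toRingHom.toAlgebra
  let : Algebra (MvPolynomial s A) M := ((algebraMap E M).comp f.toRingHom).toAlgebra
  have : IsScalarTower (MvPolynomial s A) E M := .of_algebraMap_eq fun _ ↦ rfl
  have : Algebra.EssFiniteType E M := .of_comp k E M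
  have : FiniteDimensional E M := Algebra.finite_of_essFiniteType_of_isAlgebraic
  have hfr : IsFractionRing (MvPolynomial s A) E := hf
  obtain ⟨π, O, i1, i2, i3, i4, hO, φ, h1, h2⟩ :=
    exists_embedding_of_isSeparable (A := A) hA (ι := s) E (M := M) T
  refine ⟨π, O, i1, i2, i3, i4, hO, φ, fun a ↦ ?_, h2⟩
  rw [← h1]
  congr 1
  change algebraMap A M a = ((f (MvPolynomial.C a) : E) : M)
  rw [← MvPolynomial.algebraMap_eq, f.commutes]
  rfl

theorem Algebra.EssFiniteType.of_subfield_closure_eq_top (k : Type*) {K : Type*} [Field k]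
    [Field K] [Algebra k K] {s : Finset K} (hs : Subfield.closure (s : Set K) = ⊤) :
    Algebra.EssFiniteType k K := by
  rw [← IntermediateField.fg_top_iff]
  refine ⟨s, IntermediateField.toSubfield_injective ?_⟩
  rw [IntermediateField.adjoin_toSubfield, IntermediateField.top_toSubfield]
  exact top_le_iff.1 (hs.symm.le.trans (Subfield.closure_mono Set.subset_union_right))

theorem hasLocalEmbeddings_int (K : Type) [Field K] [CharZero K]
    {s : Finset K} (hs : Subfield.closure (s : Set K) = ⊤) : HasLocalEmbeddings ℤ K := by
  have : Algebra.EssFiniteType ℚ K := .of_subfield_closure_eq_top ℚ hs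
  obtain ⟨s, hs, hsep⟩ := exists_isTranscendenceBasis_and_isSeparable_of_perfectField ℚ K
  exact hasLocalEmbeddings_of_isTranscendenceBasis hasLocalModels_int hs hsep

theorem eq_zero_of_sum_pow_mul_pow_eq_zero {p : ℕ} [Fact p.Prime] {M : Type*} [Field M] [CharP M p]
    {t : M} (ht : ∀ y, y ^ p ≠ t) (w : ℕ → M) (hw : ∑ j ∈ Finset.range p, t ^ j * w j ^ p = 0)
    {j : ℕ} (hj : j < p) : w j = 0 := by
  have hp : p.Prime := Fact.out
  let L := (frobenius M p).fieldRange
  let a : L := ⟨t ^ p, t, rfl⟩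
  have hirr : Irreducible (X ^ p - C a : L[X]) := by
    refine X_pow_sub_C_irreducible_of_prime hp fun ⟨b, y, hy⟩ h ↦ ht y ?_
    have h1 : b ^ p = t ^ p := congrArg Subtype.val h
    rw [← frobenius_def, ← frobenius_def] at h1
    rw [← frobenius_def, hy]
    exact frobenius_inj M p h1
  have hmin : minpoly L t = X ^ p - C a := by
    refine (minpoly.eq_of_irreducible_of_monic hirr ?_ (monic_X_pow_sub_C _ hp.ne_zero)).symm
    rw [map_sub, map_pow, aeval_X, aeval_C]
    exact sub_self _
  let P : L[X] := ∑ j ∈ Finset.range p, C (⟨w j ^ p, w j, rfl⟩ : L) * X ^ j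
  have hP : P = 0 := by
    by_contra hP
    have h1 := minpoly.degree_le_of_ne_zero L t hP (by
      rw [map_sum, ← hw]
      refine Finset.sum_congr rfl fun j _ ↦ ?_
      rw [map_mul, map_pow, aeval_X, aeval_C, mul_comm]
      rfl)
    rw [hmin, degree_X_pow_sub_C hp.pos] at h1
    exact (degree_sum_fin_lt fun j : Fin p ↦ (⟨w j ^ p, w j, rfl⟩ : L)).not_ge
      (by rwa [Fin.sum_univ_eq_sum_range fun j ↦ C (⟨w j ^ p, w j, rfl⟩ : L) * X ^ j])
  have h2 := congrArg (coeff · j) hP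
  simp only [P, finsetSum_coeff, coeff_C_mul_X_pow, coeff_zero] at h2
  rw [Finset.sum_ite_eq, if_pos (Finset.mem_range.2 hj)] at h2
  exact eq_zero_of_pow_eq_zero (congrArg Subtype.val h2)

theorem Polynomial.exists_eq_sum_X_pow_mul_pow {p : ℕ} [Fact p.Prime] (c : (ZMod p)[X]) :
    ∃ d : ℕ → (ZMod p)[X], c = ∑ j ∈ Finset.range p, X ^ j * d j ^ p := by
  have hp : p.Prime := Fact.out
  induction c using Polynomial.induction_on' with
  | add c c' h h' =>
    obtain ⟨d, rfl⟩ := h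
    obtain ⟨d', rfl⟩ := h'
    exact ⟨d + d', by simp [add_pow_char, mul_add, Finset.sum_add_distrib]⟩
  | monomial n a =>
    refine ⟨fun j ↦ if j = n % p then monomial (n / p) a else 0, ?_⟩
    rw [Finset.sum_eq_single_of_mem (n % p) (Finset.mem_range.2 (Nat.mod_lt _ hp.pos))]
    · beta_reduce
      rw [if_pos rfl, monomial_pow, ZMod.pow_card, X_pow_mul_monomial, Nat.div_add_mod']
    · intro j _ hj
      simp [hj, hp.ne_zero]

theorem linearIndepOn_pow {p : ℕ} [Fact p.Prime] {k M : Type*} [Field k] [Algebra (ZMod p)[X] k]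
    [IsFractionRing (ZMod p)[X] k] [Field M] [CharP M p] [Algebra k M] [Algebra (ZMod p)[X] M]
    [IsScalarTower (ZMod p)[X] k M] (ht : ∀ y : M, y ^ p ≠ algebraMap (ZMod p)[X] M X)
    (s : Finset M) (h : LinearIndepOn k id (s : Set M)) :
    LinearIndepOn k (· ^ p) (s : Set M) := by
  have hp : p.Prime := Fact.out
  rw [LinearIndepOn, ← LinearIndependent.iff_fractionRing (ZMod p)[X] k,
    Fintype.linearIndependent_iff] at h ⊢
  intro c hc i
  choose d hd using fun i ↦ Polynomial.exists_eq_sum_X_pow_mul_pow (c i)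
  have h0 (j : ℕ) (hj : j < p) : ∑ i, d i j • (i : M) = 0 := by
    refine eq_zero_of_sum_pow_mul_pow_eq_zero ht (fun j ↦ ∑ i, d i j • (i : M)) ?_ hj
    rw [← hc]
    simp_rw [sum_pow_char, Finset.mul_sum]
    rw [Finset.sum_comm]
    refine Finset.sum_congr rfl fun i _ ↦ ?_
    rw [hd i, Finset.sum_smul]
    refine Finset.sum_congr rfl fun j _ ↦ ?_
    rw [Algebra.smul_def, Algebra.smul_def, map_mul, map_pow, map_pow, mul_pow, mul_assoc]
  rw [hd i]
  refine Finset.sum_eq_zero fun j hj ↦ ?_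
  rw [h _ (h0 j (Finset.mem_range.1 hj)) i, zero_pow hp.ne_zero, mul_zero]

theorem transcendental_of_forall_pow_ne {p : ℕ} [Fact p.Prime] {M : Type*} [Field M]
    [Algebra (ZMod p) M] {t : M} (ht : ∀ y, y ^ p ≠ t) : Transcendental (ZMod p) t := by
  intro halg
  have : FiniteDimensional (ZMod p) (IntermediateField.adjoin (ZMod p) {t}) :=
    IntermediateField.adjoin.finiteDimensional halg.isIntegral
  have : Finite (IntermediateField.adjoin (ZMod p) {t}) := Module.finite_of_finite (ZMod p)
  have : CharP (IntermediateField.adjoin (ZMod p) {t}) p := charP_of_injective_algebraMap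
    (algebraMap (ZMod p) _).injective p
  obtain ⟨y, hy⟩ := (Finite.injective_iff_surjective.1
    (frobenius_inj (IntermediateField.adjoin (ZMod p) {t}) p))
    ⟨t, IntermediateField.mem_adjoin_simple_self (ZMod p) t⟩
  exact ht y (congrArg Subtype.val hy)

instance Polynomial.finite_units (R : Type*) [CommRing R] [IsDomain R] [Finite R] :
    Finite R[X]ˣ := by
  refine Finite.of_injective (fun u ↦ (u : R[X]).coeff 0) fun u v h ↦ Units.ext ?_
  rw [eq_C_of_natDegree_eq_zero (natDegree_coe_units u),
    eq_C_of_natDegree_eq_zero (natDegree_coe_units v)]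
  exact congrArg C h

theorem hasLocalEmbeddings_polynomial {p : ℕ} [Fact p.Prime] {M : Type} [Field M] [CharP M p]
    [Algebra (ZMod p) M] [Algebra.EssFiniteType (ZMod p) M] [Algebra (ZMod p)[X] M]
    (ht : ∀ y : M, y ^ p ≠ algebraMap (ZMod p)[X] M X) : HasLocalEmbeddings (ZMod p)[X] M := by
  have hinj : Function.Injective (algebraMap (ZMod p)[X] M) := by
    have h1 : algebraMap (ZMod p)[X] M =
        (aeval (R := ZMod p) (algebraMap (ZMod p)[X] M X) : (ZMod p)[X] →+* M) := by
      refine Polynomial.ringHom_ext' (Subsingleton.elim _ _) ?_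
      simp
    rw [h1]
    exact transcendental_iff_injective.1 (transcendental_of_forall_pow_ne ht)
  let k := FractionRing (ZMod p)[X]
  let : Algebra k M := (IsFractionRing.lift hinj).toAlgebra
  have : IsScalarTower (ZMod p)[X] k M :=
    .of_algebraMap_eq fun x ↦ (IsFractionRing.lift_algebraMap hinj x).symm
  have : IsScalarTower (ZMod p) k M :=
    .of_algebraMap_eq fun x ↦ DFunLike.congr_fun (Subsingleton.elim _ _ : algebraMap (ZMod p) M =
      (algebraMap k M).comp (algebraMap (ZMod p) k)) x
  have : Algebra.EssFiniteType k M := .of_comp (ZMod p) k M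
  have : CharP k p := (RingHom.charP_iff (algebraMap k M) (algebraMap k M).injective p).2 ‹_›
  have : Countable (ZMod p)[X] := Cardinal.mk_le_aleph0_iff.1
    (Polynomial.cardinalMk_le_max.trans (max_le Cardinal.mk_le_aleph0 le_rfl))
  obtain ⟨s, hs, hsep⟩ :=
    exists_isTranscendenceBasis_and_isSeparable_of_linearIndepOn_pow_of_essFiniteType (k := k)
      (K := M) p Fact.out (linearIndepOn_pow ht)
  exact hasLocalEmbeddings_of_isTranscendenceBasis (hasLocalModels_polynomial p) hs hsep

theorem Algebra.EssFiniteType.of_isAlgebraic (k E L : Type*) [Field k] [Field E] [Field L]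
    [Algebra k E] [Algebra k L] [Algebra E L] [IsScalarTower k E L] [Algebra.EssFiniteType k L]
    [Algebra.IsAlgebraic E L] : Algebra.EssFiniteType k E := by
  obtain ⟨s, hs⟩ := exists_isTranscendenceBasis k E
  have : Finite s := finite_of_algebraicIndependent
    (hs.1.map' (f := IsScalarTower.toAlgHom k E L) (algebraMap E L).injective)
  let E₀ := IntermediateField.adjoin k s
  have : Algebra.EssFiniteType k E₀ := IntermediateField.essFiniteType_iff.2
    (IntermediateField.fg_adjoin_of_finite s.toFinite)
  have : Algebra.IsAlgebraic E₀ E := by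
    have := hs.isAlgebraic_field
    rwa [Subtype.range_coe] at this
  have : Algebra.IsAlgebraic E₀ L := .trans E₀ E L
  have : Algebra.EssFiniteType E₀ L := .of_comp k E₀ L
  have : Module.Finite E₀ L := Algebra.finite_of_essFiniteType_of_isAlgebraic
  have : Module.Finite E₀ E := FiniteDimensional.left E₀ E L
  exact .comp k E₀ E

theorem exists_forall_pow_ne {p : ℕ} [Fact p.Prime] (K : Type*) [Field K] [Infinite K] [CharP K p]
    [Algebra (ZMod p) K] [Algebra.EssFiniteType (ZMod p) K] : ∃ t : K, ∀ y, y ^ p ≠ t := by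
  by_contra! H
  have : Algebra.FormallyUnramified (ZMod p) K := by
    refine ⟨?_⟩
    rw [← Submodule.subsingleton_iff (R := K), ← subsingleton_iff_bot_eq_top,
      ← KaehlerDifferential.span_range_derivation, eq_comm, Submodule.span_eq_bot]
    rintro _ ⟨x, rfl⟩
    obtain ⟨y, rfl⟩ := H x
    rw [Derivation.leibniz_pow, ← Nat.cast_smul_eq_nsmul K, CharP.cast_eq_zero, zero_smul]
  have : Algebra.IsSeparable (ZMod p) K := Algebra.FormallyUnramified.isSeparable _ _
  have : Module.Finite (ZMod p) K := Algebra.finite_of_essFiniteType_of_isAlgebraic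
  have : Finite K := Module.finite_of_finite (ZMod p)
  exact not_finite K

section

variable {O : Type*} [CommRing O] [IsDomain O] [IsDiscreteValuationRing O] {p : ℕ} [Fact p.Prime]

theorem isUnit_of_forall_exists_pow_eq_algebraMap {a : O} (ha : a ≠ 0)
    (h : ∀ n : ℕ, ∃ y : FractionRing O, y ^ p ^ n = algebraMap O _ a) : IsUnit a := by
  have hp : p.Prime := Fact.out
  by_contra hu
  refine ha (Ideal.mem_bot.1 ?_)
  rw [← Ideal.iInf_pow_eq_bot_of_isLocalRing (maximalIdeal O) (maximalIdeal.isMaximal O).ne_top,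
    Ideal.mem_iInf]
  intro n
  obtain ⟨y, hy⟩ := h n
  have hpn : 0 < p ^ n := pow_pos hp.pos n
  obtain ⟨z, rfl⟩ := IsIntegrallyClosed.isIntegral_iff.1 (IsIntegral.of_pow (R := O) hpn
    (hy ▸ isIntegral_algebraMap))
  rw [← map_pow] at hy
  rw [← IsFractionRing.injective O (FractionRing O) hy]
  refine Ideal.pow_le_pow_right (Nat.lt_pow_self hp.one_lt).le (Ideal.pow_mem_pow ?_ _)
  rw [mem_maximalIdeal]
  intro hz
  exact hu (IsFractionRing.injective O (FractionRing O) hy ▸ hz.pow _)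

theorem exists_isUnit_of_forall_exists_pow_eq {x : FractionRing O} (hx : x ≠ 0)
    (h : ∀ n : ℕ, ∃ y, y ^ p ^ n = x) : ∃ u : O, IsUnit u ∧ algebraMap O _ u = x := by
  obtain ⟨a, rfl⟩ | ⟨a, ha⟩ := ValuationRing.isInteger_or_isInteger O x
  · exact ⟨a, isUnit_of_forall_exists_pow_eq_algebraMap (by rintro rfl; simp at hx) h, rfl⟩
  · have ha0 : a ≠ 0 := by
      rintro rfl
      exact inv_ne_zero hx (by rw [← ha, map_zero])
    have hu : IsUnit a := isUnit_of_forall_exists_pow_eq_algebraMap (p := p) ha0 fun n ↦ by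
      obtain ⟨y, hy⟩ := h n
      exact ⟨y⁻¹, by rw [inv_pow, hy, ha]⟩
    obtain ⟨b, hb⟩ := hu.exists_right_inv
    refine ⟨b, .of_mul_eq_one a (by rw [mul_comm, hb]), ?_⟩
    rw [← inv_inv x, ← ha]
    exact eq_inv_of_mul_eq_one_left (by rw [← map_mul, mul_comm, hb, map_one])

theorem finite_of_forall_exists_pow_eq {F : Type*} [Field F] [Finite (ResidueField O)]
    (hF : ∀ x : F, ∃ y, y ^ p = x) (φ : F →+* FractionRing O) : Finite F := by
  have hF' (n : ℕ) : ∀ x : F, ∃ y, y ^ p ^ n = x := by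
    induction n with
    | zero => exact fun x ↦ ⟨x, by simp⟩
    | succ n ih =>
      intro x
      obtain ⟨y, rfl⟩ := hF x
      obtain ⟨z, rfl⟩ := ih y
      exact ⟨z, by rw [pow_succ, pow_mul]⟩
  have key (x : F) (hx : x ≠ 0) : ∃ u : O, IsUnit u ∧ algebraMap O _ u = φ x := by
    refine exists_isUnit_of_forall_exists_pow_eq (p := p) ((map_ne_zero φ).2 hx) fun n ↦ ?_
    obtain ⟨y, rfl⟩ := hF' n x
    exact ⟨φ y, (map_pow φ y _).symm⟩
  have key' (x : F) : ∃ u : O, algebraMap O _ u = φ x := by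
    by_cases hx : x = 0
    · exact ⟨0, by rw [hx, map_zero, map_zero]⟩
    · exact (key x hx).imp fun _ ↦ And.right
  choose o ho using key'
  refine Finite.of_injective (fun x ↦ residue O (o x)) fun x y hxy ↦ ?_
  by_contra hne
  obtain ⟨u, hu, hu'⟩ := key (x - y) (sub_ne_zero.2 hne)
  have : o x - o y = u := IsFractionRing.injective O (FractionRing O) (by
    rw [map_sub, ho, ho, hu', map_sub])
  refine (residue_ne_zero_iff_isUnit _).2 hu ?_
  rw [← this, map_sub, sub_eq_zero]
  exact hxy

end

theorem exists_mem_forall_pow_ne {p : ℕ} [Fact p.Prime] {K : Type} [Field K] [CharP K p]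
    [Algebra (ZMod p) K] [Algebra.EssFiniteType (ZMod p) K] (F : Subfield K) [Infinite F] :
    ∃ t ∈ F, ∀ y ∈ F, y ^ p ≠ t := by
  by_contra! H
  have : Infinite K := .of_injective _ F.subtype_injective
  obtain ⟨t, ht⟩ := exists_forall_pow_ne (p := p) K
  let : Algebra (ZMod p)[X] K := (aeval (R := ZMod p) t).toRingHom.toAlgebra
  obtain ⟨π, O, _, _, _, _, hO, φ, -⟩ := hasLocalEmbeddings_polynomial (p := p) (M := K)
    (fun y ↦ by
      rw [RingHom.algebraMap_toAlgebra]
      simpa using ht y) ∅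
  have := hO.finite
  have : Finite F := finite_of_forall_exists_pow_eq (O := O) (p := p) (fun ⟨x, hx⟩ ↦ by
    obtain ⟨y, hy, h⟩ := H x hx
    exact ⟨⟨y, hy⟩, Subtype.ext h⟩) (φ.comp F.subtype)
  exact not_finite F

section

variable {p : ℕ} [Fact p.Prime] {E K : Type*} [Field E] [Field K] [Algebra E K] {t : E} {a y : K}

theorem Transcendental.exists_pow_eq (ha : Transcendental E a) (hy : y ^ p = algebraMap E K t)
    (hya : y ∈ IntermediateField.adjoin E {a}) : ∃ z : E, z ^ p = t := by
  have hp : p.Prime := Fact.out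
  obtain ⟨g, h, rfl⟩ := (IntermediateField.mem_adjoin_simple_iff E y).1 hya
  by_cases hh : h = 0
  · refine ⟨0, (algebraMap E K).injective ?_⟩
    rw [← hy, hh, map_zero, div_zero, zero_pow hp.ne_zero, zero_pow hp.ne_zero, map_zero]
  have hinj := transcendental_iff_injective.1 ha
  have hh' : Polynomial.aeval a h ≠ 0 := (map_ne_zero_iff _ hinj).2 hh
  rw [div_pow, div_eq_iff (pow_ne_zero _ hh'), ← map_pow, ← map_pow, ← Polynomial.aeval_C a t,
    ← map_mul] at hy
  have h1 := congrArg leadingCoeff (hinj hy)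
  rw [leadingCoeff_pow, leadingCoeff_mul, leadingCoeff_C, leadingCoeff_pow] at h1
  exact ⟨g.leadingCoeff / h.leadingCoeff, by
    rw [div_pow, h1, mul_div_cancel_right₀ _ (pow_ne_zero _ (leadingCoeff_ne_zero.2 hh))]⟩

theorem IsSeparable.exists_pow_eq [CharP E p] (ha : IsSeparable E a)
    (hy : y ^ p = algebraMap E K t)
    (hya : y ∈ IntermediateField.adjoin E {a}) : ∃ z : E, z ^ p = t := by
  have hp : p.Prime := Fact.out
  have := (IntermediateField.isSeparable_adjoin_simple_iff_isSeparable E K).2 ha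
  have h1 : y ∈ separableClosure E K := mem_separableClosure_iff.2
    (IntermediateField.isSeparable_of_mem_isSeparable E K hya)
  have h2 : y ∈ perfectClosure E K := (mem_perfectClosure_iff_pow_mem p).2
    ⟨1, t, by rw [pow_one, hy]⟩
  have h3 : y ∈ (⊥ : IntermediateField E K) := separableClosure_inf_perfectClosure E K ▸ ⟨h1, h2⟩
  obtain ⟨z, rfl⟩ := IntermediateField.mem_bot.1 h3
  exact ⟨z, (algebraMap E K).injective (by rw [map_pow, hy])⟩

end

theorem Subfield.exists_le_forall_pow_ne_isPurelyInseparable {p : ℕ} [Fact p.Prime] {K : Type*}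
    [Field K] [CharP K p] {F : Subfield K} {t : K} (htF : t ∈ F) (ht : ∀ y ∈ F, y ^ p ≠ t) :
    ∃ E : Subfield K, F ≤ E ∧ (∀ y ∈ E, y ^ p ≠ t) ∧ IsPurelyInseparable E K := by
  have hp : p.Prime := Fact.out
  obtain ⟨E, hFE, hE⟩ := zorn_le_nonempty₀ {E : Subfield K | ∀ y ∈ E, y ^ p ≠ t}
    (fun c hc hchain E hE ↦ ⟨sSup c, fun y hy ↦ by
      obtain ⟨E', hE', hy⟩ := (Subfield.mem_sSup_of_directedOn ⟨E, hE⟩ hchain.directedOn).1 hy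
      exact hc hE' y hy, fun _ ↦ le_sSup⟩) F ht
  refine ⟨E, hFE, hE.prop, ?_⟩
  let t' : E := ⟨t, hFE htF⟩
  have hroot (a : K) (ha : a ∉ E) : ∃ y ∈ IntermediateField.adjoin E {a}, y ^ p = t := by
    by_contra! H
    have hle : E ≤ (IntermediateField.adjoin E {a}).toSubfield := fun x hx ↦
      (IntermediateField.adjoin E {a}).algebraMap_mem ⟨x, hx⟩
    exact ha (hE.le_of_ge (y := (IntermediateField.adjoin E {a}).toSubfield) H hle
      (IntermediateField.mem_adjoin_simple_self E a))
  have hne (z : E) : z ^ p ≠ t' := fun h ↦ hE.prop z z.2 (congrArg Subtype.val h)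
  have halg : Algebra.IsAlgebraic E K := by
    refine ⟨fun a ↦ ?_⟩
    by_contra ha
    obtain ⟨y, hy, hyt⟩ := hroot a fun h ↦ ha (isAlgebraic_algebraMap (⟨a, h⟩ : E))
    obtain ⟨z, hz⟩ := Transcendental.exists_pow_eq (t := t') ha hyt hy
    exact hne z hz
  refine ⟨Algebra.IsAlgebraic.isIntegral, fun a ha ↦ ?_⟩
  by_contra haE
  obtain ⟨y, hy, hyt⟩ := hroot a fun h ↦ haE ⟨⟨a, h⟩, rfl⟩
  obtain ⟨z, hz⟩ := IsSeparable.exists_pow_eq (t := t') (p := p) ha hyt hy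
  exact hne z hz

theorem exists_forall_pow_mem {p : ℕ} [Fact p.Prime] {K : Type*} [Field K] [CharP K p]
    {s : Finset K} (hs : Subfield.closure (s : Set K) = ⊤) (E : Subfield K)
    [IsPurelyInseparable E K] : ∃ n : ℕ, ∀ x : K, x ^ p ^ n ∈ E := by
  have : ExpChar K p := .prime Fact.out
  have : CharP E p := (RingHom.charP_iff E.subtype E.subtype_injective p).2 ‹_›
  have : ExpChar E p := .prime Fact.out
  choose m hm using fun x : K ↦ IsPurelyInseparable.pow_mem E p x
  refine ⟨s.sup m, fun x ↦ ?_⟩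
  have hle : Subfield.closure (s : Set K) ≤ E.comap (iterateFrobenius K p (s.sup m)) := by
    rw [Subfield.closure_le]
    intro x hx
    obtain ⟨k, hk⟩ := Nat.exists_eq_add_of_le (Finset.le_sup (f := m) hx)
    obtain ⟨y, hy⟩ := hm x
    rw [SetLike.mem_coe, Subfield.mem_comap, iterateFrobenius_def, hk, pow_add, pow_mul, ← hy]
    exact pow_mem y.2 _
  exact hle (hs ▸ Subfield.mem_top x)

theorem Algebra.EssFiniteType.of_isAlgebraic_zmod (p : ℕ) (E L : Type*) [Field E] [Field L]
    [Fact p.Prime] [Algebra (ZMod p) E] [Algebra (ZMod p) L] [Algebra E L]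
    [Algebra.EssFiniteType (ZMod p) L] [Algebra.IsAlgebraic E L] :
    Algebra.EssFiniteType (ZMod p) E :=
  have : IsScalarTower (ZMod p) E L :=
    .of_algebraMap_eq fun x ↦ DFunLike.congr_fun (Subsingleton.elim _ _ : algebraMap (ZMod p) L =
      (algebraMap E L).comp (algebraMap (ZMod p) E)) x
  .of_isAlgebraic (ZMod p) E L

theorem HasLocalEmbeddings.of_algHom {A M M' : Type} [CommRing A] [Field M] [Field M']
    [Algebra A M] [Algebra A M'] (hM : HasLocalEmbeddings A M) (f : M' →ₐ[A] M) :
    HasLocalEmbeddings A M' := by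
  classical
  intro T
  obtain ⟨π, O, i1, i2, i3, i4, hO, φ, h1, h2⟩ := hM (T.image f)
  refine ⟨π, O, i1, i2, i3, i4, hO, φ.comp f, fun a ↦ ?_, fun τ hτ ↦
    h2 _ (Finset.mem_image_of_mem f hτ)⟩
  rw [← h1, ← f.commutes]
  rfl

/-- A purely inseparable subfield containing `F`, which embeds into local fields with the image of
`A` lying inside `F`. -/
theorem exists_subfield_hasLocalEmbeddings {K : Type} [Field K]
    {s : Finset K} (hs : Subfield.closure (s : Set K) = ⊤) (F : Subfield K) [Infinite F] :
    ∃ K' : Subfield K, F ≤ K' ∧ IsPurelyInseparable K' K ∧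
      ∃ (A : Type) (_ : CommRing A) (_ : Algebra A K'), HasLocalEmbeddings A K' ∧
        (∀ a : A, (algebraMap A K' a : K) ∈ F) ∧
        ∃ (q : ℕ) (ψ : K →+* K'), q ≠ 0 ∧ ∀ x, (ψ x : K) = x ^ q := by
  obtain _ | ⟨p, hp, _⟩ := CharP.exists' K
  · refine ⟨⊤, le_top, ?_, ℤ, inferInstance, inferInstance, ?_, fun a ↦ ?_, 1,
      Subfield.topEquiv.symm.toRingHom, one_ne_zero, fun x ↦ (pow_one x).symm⟩
    · exact ⟨⟨fun x ↦ isIntegral_algebraMap (x := (⟨x, trivial⟩ : (⊤ : Subfield K)))⟩,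
        fun x _ ↦ ⟨⟨x, trivial⟩, rfl⟩⟩
    · exact (hasLocalEmbeddings_int K hs).of_algHom (Subfield.topEquiv.toRingHom.toIntAlgHom)
    · simp
  · let : Algebra (ZMod p) K := ZMod.algebra K p
    have : Algebra.EssFiniteType (ZMod p) K := .of_subfield_closure_eq_top _ hs
    obtain ⟨t, htF, ht⟩ := exists_mem_forall_pow_ne (p := p) F
    obtain ⟨K', hle, hK', hpi⟩ := Subfield.exists_le_forall_pow_ne_isPurelyInseparable htF ht
    have : CharP K' p := (RingHom.charP_iff K'.subtype K'.subtype_injective p).2 ‹_›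
    let : Algebra (ZMod p) K' := ZMod.algebra K' p
    have : Algebra.EssFiniteType (ZMod p) K' := .of_isAlgebraic_zmod p K' K
    let t' : K' := ⟨t, hle htF⟩
    let : Algebra (ZMod p)[X] K' := (aeval (R := ZMod p) t').toRingHom.toAlgebra
    have : CharP F p := (RingHom.charP_iff F.subtype F.subtype_injective p).2 ‹_›
    have halg (a : (ZMod p)[X]) : algebraMap (ZMod p)[X] K' a = aeval t' a := rfl
    obtain ⟨n, hn⟩ := exists_forall_pow_mem (p := p) hs K'
    refine ⟨K', hle, hpi, (ZMod p)[X], inferInstance, inferInstance,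
      hasLocalEmbeddings_polynomial fun y hy ↦ ?_, fun a ↦ ?_, p ^ n,
      (iterateFrobenius K p n).codRestrict K' hn, pow_ne_zero _ hp.out.ne_zero, fun x ↦ rfl⟩
    · rw [halg, aeval_X] at hy
      exact hK' y y.2 (congrArg Subtype.val hy)
    · let g : (ZMod p)[X] →+* F := eval₂RingHom (ZMod.castHom dvd_rfl F) ⟨t, htF⟩
      have hg : K'.subtype.comp (algebraMap (ZMod p)[X] K') = F.subtype.comp g := by
        refine Polynomial.ringHom_ext' (Subsingleton.elim _ _) ?_
        simp [g, halg, t']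
      have hga : (algebraMap (ZMod p)[X] K' a : K) = g a := DFunLike.congr_fun hg a
      rw [hga]
      exact (g a).2

theorem ValuationSubring.isDiscreteValuationRing_of_isLocalHom {K : Type*} [Field K]
    {V : ValuationSubring K} (hV : V ≠ ⊤) {O : Type*} [CommRing O] [IsDomain O]
    [IsDiscreteValuationRing O] (f : V →+* O) (hf : Function.Injective f) [IsLocalHom f] :
    IsDiscreteValuationRing V := by
  have hwf : WfDvdMonoid V := by
    refine ⟨Subrelation.wf (r := InvImage DvdNotUnit f) ?_
      (InvImage.wf f wellFounded_dvdNotUnit)⟩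
    rintro a b ⟨ha, c, hc, rfl⟩
    exact ⟨(map_ne_zero_iff f hf).2 ha, f c, fun h ↦ hc (isUnit_of_map_unit f c h), map_mul f a c⟩
  have : IsPrincipalIdealRing V := ((IsBezout.TFAE (R := V)).out 1 3).2 hwf
  refine { not_a_field' := fun h ↦ hV ?_ }
  rw [← isField_iff_maximalIdeal_eq] at h
  refine top_le_iff.1 fun x _ ↦ ?_
  by_contra hx
  have hx' : x⁻¹ ∈ V := (V.mem_or_inv_mem x).resolve_left hx
  obtain ⟨b, hb⟩ := h.mul_inv_cancel (a := ⟨x⁻¹, hx'⟩) fun h0 ↦ hx (by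
    have : x⁻¹ = 0 := congrArg Subtype.val h0
    rw [inv_eq_zero.1 this]
    exact V.zero_mem)
  have h1 : x⁻¹ * b = 1 := congrArg Subtype.val hb
  rw [← inv_inv x, inv_eq_of_mul_eq_one_right h1] at hx
  exact hx b.2

section

variable (O : Type*) [CommRing O] [IsDomain O] [IsDiscreteValuationRing O]
  {K : Type*} [Field K] (Ψ : K →+* FractionRing O)

/-- The pullback to `K` of the valuation of a discrete valuation ring along an embedding. -/
noncomputable def valuationSubringOfRingHom : ValuationSubring K :=
  ValuationSubring.comap
    { (algebraMap O (FractionRing O)).range with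
      mem_or_inv_mem' := ValuationRing.isInteger_or_isInteger O } Ψ

variable {O}

theorem mem_valuationSubringOfRingHom {x : K} :
    x ∈ valuationSubringOfRingHom O Ψ ↔ ∃ a, algebraMap O _ a = Ψ x :=
  Iff.rfl

theorem exists_isLocalHom_valuationSubringOfRingHom :
    ∃ f : valuationSubringOfRingHom O Ψ →+* O, Function.Injective f ∧ IsLocalHom f := by
  have hinj := IsFractionRing.injective O (FractionRing O)
  choose f hf using fun x : valuationSubringOfRingHom O Ψ ↦
    (mem_valuationSubringOfRingHom Ψ).1 x.2
  let g : valuationSubringOfRingHom O Ψ →+* O :=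
    { toFun := f
      map_one' := hinj (by rw [hf, map_one]; exact map_one Ψ)
      map_zero' := hinj (by rw [hf, map_zero]; exact map_zero Ψ)
      map_mul' := fun x y ↦ hinj (by rw [map_mul, hf, hf, hf]; exact map_mul Ψ _ _)
      map_add' := fun x y ↦ hinj (by rw [map_add, hf, hf, hf]; exact map_add Ψ _ _) }
  refine ⟨g, fun x y hxy ↦ Subtype.ext (Ψ.injective ?_), ⟨fun x hx ↦ ?_⟩⟩
  · rw [← hf, ← hf]
    exact congrArg _ hxy
  · obtain ⟨b, hb⟩ := hx.exists_right_inv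
    have h1 : Ψ x * algebraMap O _ b = 1 := by
      rw [← hf, ← map_mul]
      exact (congrArg _ hb).trans (map_one _)
    have hx0 : (x : K) ≠ 0 := fun h ↦ by simp [h] at h1
    have hmem : (x : K)⁻¹ ∈ valuationSubringOfRingHom O Ψ := ⟨b, by
      rw [map_inv₀]
      exact eq_inv_of_mul_eq_one_right h1⟩
    exact .of_mul_eq_one ⟨_, hmem⟩ (Subtype.ext (mul_inv_cancel₀ hx0))

end

section

variable {A : Type} [CommRing A] {π : A} {O : Type} [CommRing O] [IsDomain O]
  [IsDiscreteValuationRing O] [Algebra A O]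

theorem IsLocalModel.exists_pow_dvd_sub (hO : IsLocalModel π O) (n : ℕ) (x : O) :
    ∃ a, algebraMap A O π ^ n ∣ x - algebraMap A O a := by
  induction n generalizing x with
  | zero => exact ⟨0, by simp⟩
  | succ n ih =>
    obtain ⟨a, ha⟩ := hO.exists_sub_mem x
    rw [hO.irreducible.maximalIdeal_eq, Ideal.mem_span_singleton] at ha
    obtain ⟨y, hy⟩ := ha
    obtain ⟨b, z, hz⟩ := ih y
    refine ⟨a + π * b, z, ?_⟩
    rw [map_add, map_mul, ← sub_sub, hy, ← mul_sub, hz, pow_succ']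
    ring

theorem IsLocalModel.exists_pow_mul_mem (hO : IsLocalModel π O) (l : FractionRing O) :
    ∃ (n : ℕ) (c : O), algebraMap O _ c = algebraMap O _ (algebraMap A O π) ^ n * l := by
  obtain ⟨a, b, hb, rfl⟩ := IsFractionRing.div_surjective O l
  have hb0 : b ≠ 0 := nonZeroDivisors.ne_zero hb
  obtain ⟨n, u, hu⟩ := IsDiscreteValuationRing.associated_pow_irreducible hb0 hO.irreducible
  refine ⟨n, u * a, ?_⟩
  have : algebraMap O (FractionRing O) b ≠ 0 :=
    IsFractionRing.to_map_ne_zero_of_mem_nonZeroDivisors hb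
  rw [← map_pow, ← hu, map_mul, map_mul]
  field_simp

theorem IsLocalModel.exists_sub_div_eq (hO : IsLocalModel π O) (l : FractionRing O) (n : ℕ) :
    ∃ (a : A) (m : ℕ) (c : O), l - algebraMap O _ (algebraMap A O a) /
      algebraMap O _ (algebraMap A O π) ^ m = algebraMap O _ (algebraMap A O π ^ n * c) := by
  obtain ⟨m, x, hx⟩ := hO.exists_pow_mul_mem l
  obtain ⟨a, c, hc⟩ := hO.exists_pow_dvd_sub (m + n) x
  refine ⟨a, m, c, ?_⟩
  have h0 : algebraMap O (FractionRing O) (algebraMap A O π) ≠ 0 :=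
    (map_ne_zero_iff _ (IsFractionRing.injective O _)).2 hO.irreducible.ne_zero
  have h1 := congrArg (algebraMap O (FractionRing O)) hc
  rw [map_sub, hx, pow_add, mul_assoc, map_mul (algebraMap O (FractionRing O)), map_pow] at h1
  rw [← mul_right_inj' (pow_ne_zero m h0), ← h1]
  field_simp

end

theorem HasLocalEmbeddings.exists_valuationSubring {A K : Type} [CommRing A] [Field K]
    {F K' : Subfield K} [Algebra A K'] (hA : HasLocalEmbeddings A K')
    (hF : ∀ a : A, (algebraMap A K' a : K) ∈ F) {q : ℕ} (hq : q ≠ 0) (ψ : K →+* K')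
    (hψ : ∀ x, (ψ x : K) = x ^ q) (T : Finset K) :
    ∃ V : ValuationSubring K, V ≠ ⊤ ∧ IsDiscreteValuationRing V ∧ Finite (ResidueField V) ∧
      (∀ x ∈ T, x ∈ V) ∧
      ∀ x ∈ K', ∀ γ : V.ValueGroup, γ ≠ 0 → ∃ y ∈ F, V.valuation (x - y) < γ := by
  classical
  obtain ⟨π, O, _, _, _, _, hO, φ, hφ, hT⟩ := hA (T.image ψ)
  have hO' := hO.finite
  let Ψ : K →+* FractionRing O := φ.comp ψ
  have hΨ (x : K') : Ψ x = φ x ^ q := by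
    rw [← map_pow]
    exact congrArg φ (Subtype.ext (hψ x))
  let V := valuationSubringOfRingHom O Ψ
  let P := algebraMap A O π
  let ϖ : K' := algebraMap A K' π
  have hinj := IsFractionRing.injective O (FractionRing O)
  have hP : algebraMap O (FractionRing O) P ≠ 0 :=
    (map_ne_zero_iff _ hinj).2 hO.irreducible.ne_zero
  have hϖ : Ψ ϖ = algebraMap O _ (P ^ q) := by rw [hΨ, hφ, map_pow]
  have hϖ0 : (ϖ : K) ≠ 0 := fun h ↦ by
    rw [h, map_zero, map_pow] at hϖ
    exact pow_ne_zero q hP hϖ.symm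
  have hϖV : (ϖ : K)⁻¹ ∉ V := by
    rintro ⟨c, hc⟩
    rw [map_inv₀, hϖ, eq_comm, inv_eq_iff_eq_inv, eq_comm] at hc
    have h1 := inv_mul_cancel₀ (a := algebraMap O (FractionRing O) c) (by
      rintro h
      rw [h, inv_zero, map_pow] at hc
      exact pow_ne_zero q hP hc.symm)
    rw [hc, ← map_mul, ← map_one (algebraMap O (FractionRing O))] at h1
    exact hO.irreducible.not_isUnit ((isUnit_pow_iff hq).1 (.of_mul_eq_one c (hinj h1)))
  have htop : V ≠ ⊤ := fun h ↦ hϖV (h ▸ trivial)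
  obtain ⟨f, hf, hloc⟩ := exists_isLocalHom_valuationSubringOfRingHom Ψ
  refine ⟨V, htop, V.isDiscreteValuationRing_of_isLocalHom htop f hf,
    .of_injective (ResidueField.map f) (ResidueField.map f).injective,
    fun x hx ↦ hT _ (Finset.mem_image_of_mem ψ hx), fun x hx γ hγ ↦ ?_⟩
  obtain ⟨z, rfl⟩ := V.valuation_surjective γ
  have hz : z ≠ 0 := (V.valuation.ne_zero_iff).1 hγ
  obtain ⟨n, c, hc⟩ := hO.exists_pow_mul_mem (Ψ (ϖ * z))⁻¹
  obtain ⟨a, m, d, hd⟩ := hO.exists_sub_div_eq (φ ⟨x, hx⟩) n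
  refine ⟨algebraMap A K' a / ϖ ^ m, div_mem (hF a) (pow_mem (hF π) m), ?_⟩
  set y : K := algebraMap A K' a / ϖ ^ m
  have hxy : Ψ (x - y) = algebraMap O _ ((P ^ n * d) ^ q) := by
    have h1 : x - y = ((⟨x, hx⟩ - algebraMap A K' a / ϖ ^ m : K') : K) := rfl
    rw [h1, hΨ, map_sub, map_div₀, map_pow φ, hφ, hφ, hd, map_pow]
  have hmem : (ϖ * z)⁻¹ * (x - y) ∈ V := by
    obtain ⟨e, he⟩ : P ^ n ∣ (P ^ n * d) ^ q := (dvd_mul_right _ _).trans (dvd_pow_self _ hq)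
    refine ⟨c * e, ?_⟩
    rw [map_mul, map_mul Ψ, hxy, he, hc, map_inv₀, map_mul _ (P ^ n), map_pow _ P]
    ring
  rw [← V.valuation_le_one_iff, map_mul, map_inv₀, inv_mul_le_one₀ (zero_lt_iff.2
    ((V.valuation.ne_zero_iff).2 (mul_ne_zero hϖ0 hz))), map_mul] at hmem
  refine hmem.trans_lt (mul_lt_of_lt_one_left (zero_lt_iff.2 hγ) ?_)
  rw [← V.valuation_le_one_iff, not_le, map_inv₀] at hϖV
  exact (one_lt_inv₀ (zero_lt_iff.2 ((V.valuation.ne_zero_iff).2 hϖ0))).1 hϖV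

theorem ValuationSubring.pow_ne_self_of_notMem {K : Type*} [Field K] {V : ValuationSubring K}
    {t : K} (ht : t ∉ V) {k : ℕ} (hk : 2 ≤ k) : t ^ k ≠ t := by
  intro h
  have ht0 : t ≠ 0 := fun h0 ↦ ht (h0 ▸ V.zero_mem)
  have hinv : t⁻¹ ∈ V := (V.mem_or_inv_mem t).resolve_left ht
  obtain ⟨k, rfl⟩ := Nat.exists_eq_add_of_le' hk
  refine ht ?_
  have h1 : t = t⁻¹ ^ k := by
    rw [inv_pow]
    refine eq_inv_of_mul_eq_one_left (mul_left_cancel₀ ht0 ?_)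
    rw [mul_one, ← mul_assoc, ← sq, ← pow_add, add_comm, h]
  rw [h1]
  exact pow_mem hinv k

theorem ValuationSubring.lt_card_residueField {K : Type*} [Field K] {V : ValuationSubring K}
    [Finite (ResidueField V)] {t : K} (ht : t ∈ V) (hne : ∀ k, 2 ≤ k → t ^ k ≠ t) {N : ℕ}
    (hinv : ∀ k ∈ Finset.Icc 2 N, (t ^ k - t)⁻¹ ∈ V) : N < Nat.card (ResidueField V) := by
  by_contra! hle
  have hcard : 2 ≤ Nat.card (ResidueField V) := Finite.one_lt_card
  have := Fintype.ofFinite (ResidueField V)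
  set k := Nat.card (ResidueField V) with hk
  let a : V := ⟨t, ht⟩
  have hu : IsUnit (a ^ k - a) := .of_mul_eq_one ⟨_, hinv k (Finset.mem_Icc.2 ⟨hcard, hle⟩)⟩
    (Subtype.ext (mul_inv_cancel₀ (sub_ne_zero.2 (hne k hcard))))
  refine (residue_ne_zero_iff_isUnit _).2 hu ?_
  rw [map_sub, map_pow, hk, Nat.card_eq_fintype_card, FiniteField.pow_card, sub_self]

/-- (Prasad–Rapinchuk, Lemma 5.4.) Let `K` be a finitely generated field, `F` an infinite
subfield of `K`, and `R ⊆ K` a finitely generated subring. Then there exists a subfield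
`K' ⊆ K` containing `F` with `K/K'` purely inseparable such that for every `r ≥ 1` there are
`r` discrete valuations `v 1, …, v r` of `K` such that: (1) each completion `K_{v i}` is
locally compact (equivalently: `v i` is a nontrivial discrete valuation with finite residue
field), `R` is contained in the valuation ring of `v i`, and the closures of `F` and of `K'`
in `K_{v i}` coincide (i.e. every element of `K'` can be `v i`-adically approximated by
elements of `F`); and (2) for `i ≠ j` the residue fields of `v i` and `v j` have different
(finite) cardinalities. -/
theorem exists_purely_inseparable_subfield_and_valuations
    {K : Type} [Field K]
    (hKfg : ∃ s : Finset K, Subfield.closure (s : Set K) = ⊤)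
    (F : Subfield K) [Infinite ↥F]
    (R : Subring K) (hRfg : ∃ s : Finset K, Subring.closure (s : Set K) = R) :
    ∃ K' : Subfield K, F ≤ K' ∧ IsPurelyInseparable ↥K' K ∧
      ∀ r : ℕ, 1 ≤ r →
        ∃ v : Fin r → ValuationSubring K,
          (∀ i, (v i) ≠ ⊤ ∧ IsDiscreteValuationRing ↥(v i) ∧
            Finite (IsLocalRing.ResidueField ↥(v i)) ∧
            (∀ x ∈ R, x ∈ v i) ∧
            (∀ x ∈ K', ∀ γ : (v i).ValueGroup, γ ≠ 0 →
              ∃ y ∈ F, (v i).valuation (x - y) < γ)) ∧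
          (∀ i j, i ≠ j →
            Nat.card (IsLocalRing.ResidueField ↥(v i)) ≠
              Nat.card (IsLocalRing.ResidueField ↥(v j))) := by
  classical
  obtain ⟨s, hs⟩ := hKfg
  obtain ⟨sR, rfl⟩ := hRfg
  obtain ⟨K', hFK', hpi, A, _, _, hA, hAF, q, ψ, hq, hψ⟩ := exists_subfield_hasLocalEmbeddings hs F
  have key := hA.exists_valuationSubring hAF hq ψ hψ
  obtain ⟨V₀, hV₀, -⟩ := key ∅
  obtain ⟨t, ht⟩ : ∃ t, t ∉ V₀ := by
    by_contra! h
    exact hV₀ (eq_top_iff.2 fun x _ ↦ h x)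
  choose V htop hdvr hfin hmem hdense using fun N : ℕ ↦
    key (insert t sR ∪ (Finset.Icc 2 N).image fun k ↦ (t ^ k - t)⁻¹)
  have hcard (N : ℕ) : N < Nat.card (ResidueField (V N)) := by
    have := hfin N
    refine ValuationSubring.lt_card_residueField (hmem N t (by simp))
      (fun k ↦ ValuationSubring.pow_ne_self_of_notMem ht) fun k hk ↦ hmem N _ ?_
    exact Finset.mem_union_right _ (Finset.mem_image_of_mem _ hk)
  have hR (N : ℕ) : Subring.closure (sR : Set K) ≤ (V N).toSubring :=
    (Subring.closure_le).2 fun x hx ↦ hmem N x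
      (Finset.mem_union_left _ (Finset.mem_insert_of_mem hx))
  let n : ℕ → ℕ := fun i ↦ (fun N ↦ Nat.card (ResidueField (V N)))^[i] 0
  have hn (i : ℕ) : n (i + 1) = Nat.card (ResidueField (V (n i))) :=
    Function.iterate_succ_apply' _ _ _
  have hmono : StrictMono n := strictMono_nat_of_lt_succ fun i ↦ by
    rw [hn]
    exact hcard _
  refine ⟨K', hFK', hpi, fun r _ ↦ ⟨fun i ↦ V (n i), fun i ↦ ⟨htop _, hdvr _, hfin _,
    fun x hx ↦ hR _ hx, hdense _⟩, fun i j hij h ↦ hij (Fin.ext ?_)⟩⟩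
  rw [← hn, ← hn] at h
  exact Nat.succ_injective (hmono.injective h)
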